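/- arXiv:1607.05830 — 2 statements merged into one kernel-verified Lean document; each statement's English description precedes it below -/
import Mathlib

section
/- For all probability measures μ and ν on (Set H, 𝔅), one has μ ⊑ μ & ν and ν ⊑ μ & ν, where μ & ν is the parallel composition of μ and ν; that is, for every Scott-open U, μ(U) ≤ (μ & ν)(U) and ν(U) ≤ (μ & ν)(U). -/
open MeasureTheory Set

/-- A set of subsets of `H` is Scott-open if it is an upper set for inclusion and
meets every directed family of subsets whose union it contains. -/
def ScottOpen {H : Type*} (U : Set (Set H)) : Prop :=
  (∀ ⦃a b : Set H⦄, a ⊆ b → a ∈ U → b ∈ U) ∧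
  ∀ D : Set (Set H), D.Nonempty → DirectedOn (· ⊆ ·) D → ⋃₀ D ∈ U → (D ∩ U).Nonempty

/-- The Borel σ-algebra on `Set H` generated by the Scott-open sets. -/
def scottBorel (H : Type*) : MeasurableSpace (Set H) :=
  MeasurableSpace.generateFrom {U : Set (Set H) | ScottOpen U}

/-- The order `μ ⊑ ν` on measures: `μ U ≤ ν U` for every Scott-open `U`. -/
def MeasLE {H : Type*} (μ ν : @Measure (Set H) (scottBorel H)) : Prop :=
  ∀ U : Set (Set H), ScottOpen U → μ U ≤ ν U

/-- Parallel composition `μ & ν`: the pushforward of the product measure `μ × ν`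
under the union map `(a, b) ↦ a ∪ b`. -/
noncomputable def parComp {H : Type*} (μ ν : @Measure (Set H) (scottBorel H)) :
    @Measure (Set H) (scottBorel H) :=
  @Measure.map (Set H × Set H) (Set H)
    (@Prod.instMeasurableSpace _ _ (scottBorel H) (scottBorel H)) (scottBorel H)
    (fun p => p.1 ∪ p.2)
    (@Measure.prod (Set H) (Set H) (scottBorel H) (scottBorel H) μ ν)

theorem ScottOpen.setOf_mem {H : Type*} (x : H) : ScottOpen {a : Set H | x ∈ a} := by
  refine ⟨fun a b hab hx => hab hx, ?_⟩
  rintro D - - ⟨a, ha, hx⟩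
  exact ⟨a, ha, hx⟩

/-- A Scott-open set containing `a` contains a finite subset of `a`. -/
theorem ScottOpen.exists_finset_subset {H : Type*} {U : Set (Set H)} (hU : ScottOpen U)
    {a : Set H} (ha : a ∈ U) : ∃ F : Finset H, (F : Set H) ⊆ a ∧ (F : Set H) ∈ U := by
  classical
  obtain ⟨_, ⟨F, hF, rfl⟩, hFU⟩ :=
    hU.2 ((fun F : Finset H => (F : Set H)) '' {F | (F : Set H) ⊆ a}) ⟨_, ∅, by simp, rfl⟩
      (by
        rintro _ ⟨F, hF, rfl⟩ _ ⟨G, hG, rfl⟩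
        exact ⟨_, ⟨F ∪ G, by simpa using ⟨hF, hG⟩, rfl⟩, by simp, by simp⟩)
      (hU.1 (fun x hx => ⟨_, ⟨{x}, by simpa using hx, rfl⟩, by simp⟩) ha)
  exact ⟨F, hF, hFU⟩

/-- Over a countable type, a map is Borel measurable as soon as each membership event is. -/
theorem measurable_scottBorel_of_mem {Ω H : Type*} [MeasurableSpace Ω] [Countable H]
    {f : Ω → Set H} (hf : ∀ x, MeasurableSet {ω | x ∈ f ω}) :
    @Measurable Ω (Set H) _ (scottBorel H) f := by
  refine measurable_generateFrom fun U hU => ?_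
  have hpre : f ⁻¹' U = ⋃ F ∈ {F : Finset H | (F : Set H) ∈ U}, ⋂ x ∈ F, {ω | x ∈ f ω} := by
    ext ω
    simp only [mem_preimage, mem_iUnion, mem_iInter, mem_ofPred_eq, exists_prop]
    constructor
    · intro h
      obtain ⟨F, hF, hFU⟩ := ScottOpen.exists_finset_subset hU h
      exact ⟨F, hFU, fun x hx => hF hx⟩
    · rintro ⟨F, hFU, hF⟩
      exact hU.1 (fun x hx => hF x hx) hFU
  rw [hpre]
  exact MeasurableSet.biUnion (to_countable _) fun F _ => F.measurableSet_biInter fun x _ => hf x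

theorem measurable_union_scottBorel (H : Type*) [Countable H] :
    @Measurable (Set H × Set H) (Set H)
      (@Prod.instMeasurableSpace _ _ (scottBorel H) (scottBorel H)) (scottBorel H)
      (fun p => p.1 ∪ p.2) := by
  let := scottBorel H
  have hmem (x : H) : MeasurableSet {a : Set H | x ∈ a} :=
    MeasurableSpace.measurableSet_generateFrom (ScottOpen.setOf_mem x)
  exact measurable_scottBorel_of_mem fun x =>
    (measurable_fst (hmem x)).union (measurable_snd (hmem x))

/-- `μ ⊑ μ & ν` and `ν ⊑ μ & ν` for all probability measures `μ, ν`. -/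
theorem le_parComp {H : Type*} [Countable H]
    (μ ν : @Measure (Set H) (scottBorel H))
    (hμ : @IsProbabilityMeasure (Set H) (scottBorel H) μ)
    (hν : @IsProbabilityMeasure (Set H) (scottBorel H) ν) :
    MeasLE μ (parComp μ ν) ∧ MeasLE ν (parComp μ ν) := by
  let := scottBorel H
  refine ⟨fun U hU => ?_, fun U hU => ?_⟩ <;>
    rw [parComp, Measure.map_apply (measurable_union_scottBorel H)
      (MeasurableSpace.measurableSet_generateFrom hU)]
  · calc μ U = μ.prod ν (U ×ˢ univ) := by rw [Measure.prod_prod, measure_univ, mul_one]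
      _ ≤ _ := measure_mono fun p hp => hU.1 subset_union_left hp.1
  · calc ν U = μ.prod ν (univ ×ˢ U) := by rw [Measure.prod_prod, measure_univ, one_mul]
      _ ≤ _ := measure_mono fun p hp => hU.1 subset_union_right hp.2
end

section
/- For every probability measure μ on (Set H, 𝔅) and every finite set b ⊆ H: μ ⊑ δ_b if and only if μ = μ|b, where δ_b is the Dirac measure at the set b and μ|b is the restriction of μ to b. -/
open MeasureTheory Set ENNReal

/-- The atom `A_{a,b} = {c | c ∩ b = a}`. -/
def Atom {H : Type*} (a b : Set H) : Set (Set H) := {c | c ∩ b = a}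

/-- The restriction `μ|b` of a measure `μ` to a finite set `b`:
the finite discrete measure `∑_{a ⊆ b} μ(A_{a,b}) · δ_a`. -/
noncomputable def restrictMeas {H : Type*} [DecidableEq H]
    (μ : @Measure (Set H) (scottBorel H)) (b : Finset H) :
    @Measure (Set H) (scottBorel H) :=
  ∑ a ∈ b.powerset,
    μ (Atom (↑a) (↑b)) • @Measure.dirac (Set H) (scottBorel H) (↑a : Set H)

section

attribute [local instance] scottBorel

theorem scottOpen_setOf_mem {H : Type*} (h : H) : ScottOpen {c : Set H | h ∈ c} := by
  refine ⟨fun a b hab ha => hab ha, fun D _ _ hD => ?_⟩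
  obtain ⟨c, hcD, hc⟩ := hD
  exact ⟨c, hcD, hc⟩

theorem ScottOpen.measurableSet {H : Type*} {U : Set (Set H)} (hU : ScottOpen U) :
    MeasurableSet U :=
  MeasurableSpace.measurableSet_generateFrom hU

theorem measurableSet_atom {H : Type*} (a : Set H) (b : Finset H) :
    MeasurableSet (Atom a (b : Set H)) := by
  have hEq : Atom a (b : Set H) =
      {_c | a ⊆ b} ∩ ⋂ h ∈ b, {c : Set H | h ∈ c ↔ h ∈ a} := by
    ext c
    simp only [Atom, mem_ofPred_eq, mem_inter_iff, mem_iInter]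
    constructor
    · rintro rfl
      exact ⟨inter_subset_right, fun h hb => by simp [hb]⟩
    · rintro ⟨hab, hc⟩
      ext h
      exact ⟨fun hh => (hc h hh.2).1 hh.1, fun hh => ⟨(hc h (hab hh)).2 hh, hab hh⟩⟩
  rw [hEq]
  refine (MeasurableSet.const _).inter (b.measurableSet_biInter fun h _ => ?_)
  by_cases ha : h ∈ a
  · simpa [ha] using (scottOpen_setOf_mem h).measurableSet
  · simpa [ha, compl_ofPred] using (scottOpen_setOf_mem h).measurableSet.compl

theorem restrictMeas_apply {H : Type*} [DecidableEq H] (μ : Measure (Set H)) (b : Finset H)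
    {S : Set (Set H)} (hS : MeasurableSet S) :
    restrictMeas μ b S =
      ∑ a ∈ b.powerset, μ (Atom (a : Set H) (b : Set H)) * S.indicator 1 (a : Set H) := by
  simp [restrictMeas, Measure.finsetSum_apply, Measure.dirac_apply' _ hS]

theorem MeasLE.ae_subset {H : Type*} [Countable H] {μ : Measure (Set H)} {b : Set H}
    (hle : MeasLE μ (Measure.dirac b)) : ∀ᵐ c ∂μ, c ⊆ b := by
  have hall : ∀ h : H, ∀ᵐ c ∂μ, h ∈ c → h ∈ b := fun h => by
    by_cases hb : h ∈ b
    · simp [hb]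
    · have h0 := hle _ (scottOpen_setOf_mem h)
      rw [Measure.dirac_apply' _ (scottOpen_setOf_mem h).measurableSet] at h0
      simpa [ae_iff, hb] using h0
  filter_upwards [ae_all_iff.2 hall] with c hc using hc

theorem measure_eq_sum_inter_atom {H : Type*} (μ : Measure (Set H)) (b : Finset H)
    {S : Set (Set H)} (hS : MeasurableSet S) :
    μ S = ∑ a ∈ b.powerset, μ (S ∩ Atom (a : Set H) (b : Set H)) := by
  classical
  rw [← measure_biUnion_finset]
  · congr 1
    ext c
    simp only [mem_iUnion, mem_inter_iff, Atom, mem_ofPred_eq, Finset.mem_powerset, exists_prop]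
    refine ⟨fun hc => ⟨b.filter (· ∈ c), Finset.filter_subset _ _, hc, ?_⟩, ?_⟩
    · ext h
      simp [and_comm]
    · rintro ⟨a, _, hc, _⟩
      exact hc
  · intro a _ a' _ hne
    refine Set.disjoint_left.2 fun c hc hc' => hne (Finset.coe_injective ?_)
    exact hc.2.symm.trans hc'.2
  · exact fun a _ => hS.inter (measurableSet_atom _ _)

theorem MeasLE.eq_restrictMeas {H : Type*} [Countable H] [DecidableEq H]
    {μ : Measure (Set H)} {b : Finset H} (hle : MeasLE μ (Measure.dirac (b : Set H))) :
    μ = restrictMeas μ b := by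
  refine Measure.ext fun S hS => ?_
  rw [restrictMeas_apply μ b hS, measure_eq_sum_inter_atom μ b hS]
  refine Finset.sum_congr rfl fun a _ => ?_
  have key : ∀ᵐ c ∂μ, c ∈ Atom (a : Set H) (b : Set H) → c = a := by
    filter_upwards [hle.ae_subset] with c hc hca
    rwa [Atom, mem_ofPred_eq, inter_eq_left.2 hc] at hca
  by_cases ha : (a : Set H) ∈ S
  · rw [indicator_of_mem ha, Pi.one_apply, mul_one]
    refine measure_congr (Filter.eventuallyEq_set.2 ?_)
    filter_upwards [key] with c hc
    exact ⟨fun h => h.2, fun h => ⟨hc h ▸ ha, h⟩⟩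
  · rw [indicator_of_notMem ha, mul_zero]
    refine measure_eq_zero_iff_ae_notMem.2 ?_
    filter_upwards [key] with c hc h
    exact ha (hc h.2 ▸ h.1)

theorem measLE_dirac_of_eq_restrictMeas {H : Type*} [DecidableEq H]
    {μ : Measure (Set H)} [IsProbabilityMeasure μ] {b : Finset H}
    (hEq : μ = restrictMeas μ b) : MeasLE μ (Measure.dirac (b : Set H)) := by
  intro U hU
  rw [Measure.dirac_apply' _ hU.measurableSet]
  by_cases hb : (b : Set H) ∈ U
  · rw [indicator_of_mem hb]
    exact prob_le_one
  · rw [hEq, restrictMeas_apply μ b hU.measurableSet, Finset.sum_eq_zero]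
    · exact zero_le
    · intro a ha
      rw [indicator_of_notMem, mul_zero]
      exact fun haU => hb (hU.1 (Finset.coe_subset.2 (Finset.mem_powerset.1 ha)) haU)

end

/-- `μ ⊑ δ_b` iff `μ = μ|b`. -/
theorem measLE_dirac_iff_eq_restrict {H : Type*} [Countable H] [DecidableEq H]
    (μ : @Measure (Set H) (scottBorel H))
    (hμ : @IsProbabilityMeasure (Set H) (scottBorel H) μ)
    (b : Finset H) :
    MeasLE μ (@Measure.dirac (Set H) (scottBorel H) (↑b : Set H)) ↔
      μ = restrictMeas μ b := by
  exact ⟨fun h => h.eq_restrictMeas, measLE_dirac_of_eq_restrictMeas⟩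
end
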